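/- Let P' be a refined plan of a solution P# for an effect-safe task T# such that P' is a solution and satisfies, for every (t, a) ∈ P', the bounds refine_{P'}(v, (t, t)) < t for v ∈ pre_s(a), refine_{P'}(v, (t_{ind(t)+1}, t + dur(a))) ≤ t for v ∈ pre_inv(a), and refine_{P'}(v, (t + dur(a), t + dur(a))) < t + dur(a) for v ∈ pre_e(a). Let (t0, a0) ∈ P' with a0 = a1 ⊕ a2, and let P = {(t1, a1), (t2, a2)} ∪ P' ∖ {(t0, a0)} be a refined plan obtained by splitting (t0, a0). Then, for each v ∈ pre_s(a1), refine_P(v, (t1, t1)) = refine_{P'}(v, (t0, t0)) < t1. -/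

import Mathlib

open Set

/-- A durative action over atoms of type `α`:
duration, preconditions at start / as invariant / at end,
and positive/negative effects at start and end. -/
structure DAction (α : Type*) where
  dur : ℝ
  preS : Set α
  preInv : Set α
  preE : Set α
  effSp : Set α
  effSm : Set α
  effEp : Set α
  effEm : Set α

namespace DAction

/-- Well-formedness of a durative action. -/
def WF {α : Type*} (a : DAction α) : Prop :=
  0 < a.dur ∧ a.effSm ∩ (a.effSp ∪ a.preInv) = ∅ ∧ a.effEm ∩ a.effEp = ∅

/-- All atoms of an action belong to `V`. -/
def Over {α : Type*} (a : DAction α) (V : Set α) : Prop :=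
  a.preS ⊆ V ∧ a.preInv ⊆ V ∧ a.preE ⊆ V ∧
  a.effSp ⊆ V ∧ a.effSm ⊆ V ∧ a.effEp ⊆ V ∧ a.effEm ⊆ V

end DAction

/-- A scheduled effect `(t, preInv, preE, effEp, effEm)`,
recording the end time, invariant, end precondition and end effects
of an action that has started but not yet ended. -/
abbrev Sched (α : Type*) := ℝ × Set α × Set α × Set α × Set α

/-- The scheduled effect added when action `a` starts at time `t`. -/
def schedOf {α : Type*} (t : ℝ) (a : DAction α) : Sched α :=
  (t + a.dur, a.preInv, a.preE, a.effEp, a.effEm)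

/-- The tuple identifying an ending event of action `a` at time `t`. -/
def endTuple {α : Type*} (t : ℝ) (a : DAction α) : Sched α :=
  (t, a.preInv, a.preE, a.effEp, a.effEm)

/-- A time-stamped state `(t, s, E)`. -/
abbrev TState (α : Type*) := ℝ × Set α × Set (Sched α)

section Plans

variable {α β : Type*}

/-- `P` is a (valid) plan, where the elements of `β` labelling time stamps are
interpreted as durative actions via `f`: finitely many time-stamped actions with
positive starting times and mutually disjoint starting and ending times. -/
def IsPlan (f : β → DAction α) (P : Set (ℝ × β)) : Prop :=
  P.Finite ∧ (∀ p ∈ P, 0 < p.1) ∧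
  ∀ p ∈ P, ∀ q ∈ P, p ≠ q →
    p.1 ≠ q.1 ∧ p.1 + (f p.2).dur ≠ q.1 ∧
    p.1 + (f p.2).dur ≠ q.1 + (f q.2).dur

/-- Candidate time stamps for the next event after state `st`. -/
def candTimes (f : β → DAction α) (P : Set (ℝ × β)) (st : TState α) : Set ℝ :=
  {t | ∃ b, (t, b) ∈ P ∧ st.1 < t} ∪ {t | ∃ e ∈ st.2.2, e.1 = t}

/-- One construction step of the induced sequence of time-stamped states
at position `i ≥ 1`: the new time stamp is the least candidate time, and the
state and scheduled effects are updated according to a starting or ending event. -/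
def StepAt (f : β → DAction α) (P : Set (ℝ × β)) (σ : ℕ → TState α) (i : ℕ) : Prop :=
  ((σ i).1 ∈ candTimes f P (σ (i - 1)) ∧
    ∀ t ∈ candTimes f P (σ (i - 1)), (σ i).1 ≤ t) ∧
  ((∃ b, ((σ i).1, b) ∈ P ∧
      (σ i).2.1 = (f b).effSp ∪ ((σ (i - 1)).2.1 \ (f b).effSm) ∧
      (σ i).2.2 = insert (schedOf (σ i).1 (f b)) (σ (i - 1)).2.2) ∨
   (∃ e ∈ (σ (i - 1)).2.2, e.1 = (σ i).1 ∧
      (σ i).2.1 = e.2.2.2.1 ∪ ((σ (i - 1)).2.1 \ e.2.2.2.2) ∧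
      (σ i).2.2 = (σ (i - 1)).2.2 \ {e}))

/-- `σ` is the sequence of `2|P|+1` time-stamped states induced by plan `P`
with initial state `s0`. -/
def InducedSeq (f : β → DAction α) (P : Set (ℝ × β)) (s0 : Set α)
    (σ : ℕ → TState α) : Prop :=
  σ 0 = (0, s0, ∅) ∧ ∀ i, 1 ≤ i → i ≤ 2 * P.ncard → StepAt f P σ i

/-- Consistency of a plan `P` with induced sequence `σ`: invariants of all
scheduled effects hold, and start/end preconditions hold at the
corresponding events. -/
def Consistent (f : β → DAction α) (P : Set (ℝ × β)) (σ : ℕ → TState α) : Prop :=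
  ∀ i, 1 ≤ i → i ≤ 2 * P.ncard →
    (∀ e ∈ (σ i).2.2, e.2.1 ⊆ (σ i).2.1) ∧
    (∀ b, ((σ i).1, b) ∈ P → (f b).preS ⊆ (σ (i - 1)).2.1) ∧
    (∀ e ∈ (σ (i - 1)).2.2, e.1 = (σ i).1 → e.2.2.1 ⊆ (σ (i - 1)).2.1)

end Plans

section Macro

variable {α : Type*}

/-- The macro-action `a1 ⊕ a2` of Definition 1. -/
def macroComp (a1 a2 : DAction α) : DAction α where
  dur := a1.dur + a2.dur
  preS := a1.preS ∪ (((a1.preInv ∪ a1.preE) ∩ (a1.effEm ∪ a2.effSm)) \ a1.effSp) ∪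
    ((a2.preS ∩ a2.effSm) \ (a1.effSp ∪ a1.effEp))
  preInv := ((a1.preInv ∪ a1.preE) \ ((a1.effEm ∪ a2.effSm) \ a1.effSm)) ∪
    (a2.preS \ (a1.effEp ∪ (a2.effSm \ (a1.effSm ∪ a1.effEm)))) ∪
    (a2.preInv \ (a1.effEp ∪ a2.effSp))
  preE := a2.preE \ (a1.effEp ∪ a2.effSp)
  effSp := a1.effSp \ (a1.effEm ∪ a2.effSm)
  effSm := a1.effSm ∪ (a1.effEm ∪ a2.effSm)
  effEp := a2.effEp ∪ ((a1.effEp ∪ a2.effSp) \ (a2.effSm ∪ a2.effEm))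
  effEm := a2.effEm

/-- The provisos under which the composition `a1 ⊕ a2` is defined. -/
def MacroDefined (a1 a2 : DAction α) : Prop :=
  (macroComp a1 a2).effSm ∩ (macroComp a1 a2).preInv = ∅ ∧
  (a2.preE ∩ (a1.effEm ∪ a2.effSm)) \ a2.effSp = ∅

/-- Mutex atoms: `(true, v)` represents `x(v)` and `(false, v)` represents `x(¬v)`. -/
abbrev Mux (α : Type*) := Bool × α

/-- The mutex atoms contributed by composing `a1` and `a2`,
given the mutex atoms `aux2` of `a2`. -/
def auxComp (a1 a2 : DAction α) (aux2 : Set (Mux α)) : Set (Mux α) :=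
  {m | m.1 = false ∧ m.2 ∈
      ((((a1.effEp ∪ a2.effSp) \ (a2.effEp ∪ (a2.effSm ∪ a2.effEm))) ∪
        ((a1.preInv ∪ a1.preE) ∩ (a1.effEm ∪ a2.effSm)) ∪
        ((a2.preS ∩ a2.effSm) \ a1.effEp) ∪
        ((a2.preInv ∪ a2.preE) ∩ (a1.effEp ∪ a2.effSp))) \
        (macroComp a1 a2).preInv)} ∪
  {m | m.1 = true ∧ m.2 ∈ a1.effEm ∪ a2.effSm} ∪ aux2

/-- Action terms: either an ordinary durative action, or a (right-associatively
chained) composition of two action terms into a macro-action. -/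
inductive ActTerm (α : Type*) where
  | prim : DAction α → ActTerm α
  | comp : ActTerm α → ActTerm α → ActTerm α

namespace ActTerm

/-- The durative action denoted by an action term. -/
def toA : ActTerm α → DAction α
  | .prim a => a
  | .comp b1 b2 => macroComp b1.toA b2.toA

/-- The mutex atoms associated with an action term
(`∅` for an ordinary action). -/
def aux : ActTerm α → Set (Mux α)
  | .prim _ => ∅
  | .comp b1 b2 => auxComp b1.toA b2.toA b2.aux

/-- Whether an action term is an ordinary (non-macro) action. -/
def IsPrim : ActTerm α → Prop
  | .prim _ => True
  | .comp _ _ => False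

/-- Well-formedness of an action term: all constituent actions are well-formed
and every composition along the term is defined. -/
def Good : ActTerm α → Prop
  | .prim a => a.WF
  | .comp b1 b2 => b1.Good ∧ b2.Good ∧ MacroDefined b1.toA b2.toA

/-- All atoms of an action term belong to `V`. -/
def OverT (V : Set α) : ActTerm α → Prop
  | .prim a => a.Over V
  | .comp b1 b2 => b1.OverT V ∧ b2.OverT V

end ActTerm

end Macro

section EffectSafe

variable {α : Type*}

/-- The extended atom type `V ∪ X`: original atoms plus mutex atoms. -/
abbrev ExtAtom (α : Type*) := α ⊕ Mux α

/-- The literals of `eff_s(a)`, encoded as mutex-atom indices: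
`(true, v)` for `v ∈ eff_s+(a)` and `(false, v)` for `v ∈ eff_s−(a)`. -/
def litStart (a : DAction α) : Set (Mux α) :=
  {m | (m.1 = true ∧ m.2 ∈ a.effSp) ∨ (m.1 = false ∧ m.2 ∈ a.effSm)}

/-- The literals of `eff_e(a)`, encoded as mutex-atom indices. -/
def litEnd (a : DAction α) : Set (Mux α) :=
  {m | (m.1 = true ∧ m.2 ∈ a.effEp) ∨ (m.1 = false ∧ m.2 ∈ a.effEm)}

/-- The effect-safe version `a#` of an action term `b`, over the extended atom
type, relative to the set `X` of all mutex atoms of the task (Definition 2). -/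
def safeA (X : Set (Mux α)) (b : ActTerm α) : DAction (ExtAtom α) where
  dur := b.toA.dur
  preS := Sum.inl '' b.toA.preS ∪ Sum.inr ''
    (b.aux ∪ {m | m ∈ X ∧ m.1 = true ∧ (false, m.2) ∈ b.aux} ∪ (X ∩ litStart b.toA))
  preInv := Sum.inl '' b.toA.preInv
  preE := Sum.inl '' b.toA.preE ∪ Sum.inr '' ((X \ b.aux) ∩ litEnd b.toA)
  effSp := Sum.inl '' b.toA.effSp
  effSm := Sum.inl '' b.toA.effSm ∪ Sum.inr '' b.aux
  effEp := Sum.inl '' b.toA.effEp ∪ Sum.inr '' b.aux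
  effEm := Sum.inl '' b.toA.effEm

/-- The set `X` of all mutex atoms of the actions in `A`. -/
def auxOf (A : Set (ActTerm α)) : Set (Mux α) := ⋃ b ∈ A, b.aux

/-- Well-formedness of a temporal planning task `(V, A, s0, g)`. -/
def TaskWF (V : Set α) (A : Set (ActTerm α)) (s0 g : Set α) : Prop :=
  V.Finite ∧ s0 ⊆ V ∧ g ⊆ V ∧ ∀ b ∈ A, b.Good ∧ b.OverT V

/-- `P` is a solution for the effect-safe task `T# = (V ∪ X, A#, s0 ∪ X, g)`
of the task `(V, A, s0, g)`: its actions belong to `A`, it is a valid plan of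
the effect-safe actions, and its induced sequence is consistent and reaches
the goal. -/
def SafeSolution (A : Set (ActTerm α)) (s0 g : Set α)
    (P : Set (ℝ × ActTerm α)) : Prop :=
  (∀ p ∈ P, p.2 ∈ A) ∧ IsPlan (safeA (auxOf A)) P ∧
  ∃ σ, InducedSeq (safeA (auxOf A)) P (Sum.inl '' s0 ∪ Sum.inr '' auxOf A) σ ∧
    Consistent (safeA (auxOf A)) P σ ∧
    Sum.inl '' g ⊆ (σ (2 * P.ncard)).2.1

/-- `P` is a solution for the original task with initial state `s0` and goal
`g`, interpreting action terms by the durative actions they denote. -/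
def OrigSolution (s0 g : Set α) (P : Set (ℝ × ActTerm α)) : Prop :=
  IsPlan ActTerm.toA P ∧
  ∃ σ, InducedSeq ActTerm.toA P s0 σ ∧ Consistent ActTerm.toA P σ ∧
    g ⊆ (σ (2 * P.ncard)).2.1

end EffectSafe

section Refine

variable {α β : Type*}

/-- The event time stamps of a plan `P`: `0` together with all starting and
ending times of its time-stamped actions. -/
def evTimes (f : β → DAction α) (P : Set (ℝ × β)) : Set ℝ :=
  insert 0 ({t | ∃ b, (t, b) ∈ P} ∪ {t | ∃ p ∈ P, p.1 + (f p.2).dur = t})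

/-- `δ_{P}(t0, a0)` for a macro-action with first-part duration `d1` and total
duration `d`: the minimum positive difference between `t0`, `t0 + d1`, `t0 + d`
and the earlier event time stamps of `P`. -/
noncomputable def delta (f : β → DAction α) (P : Set (ℝ × β)) (t0 d1 d : ℝ) : ℝ :=
  sInf {x | ∃ s ∈ evTimes f P,
    (x = t0 - s ∧ s < t0) ∨ (x = t0 + d1 - s ∧ s < t0 + d1) ∨
    (x = t0 + d - s ∧ s < t0 + d)}

/-- The plan obtained from `P'` by splitting the time-stamped macro-action
`(t0, b1 ⊕ b2)` into `(t1, b1)` and `(t2, b2)`. -/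
def splitPlan (P' : Set (ℝ × ActTerm α)) (t0 t1 t2 : ℝ) (b1 b2 : ActTerm α) :
    Set (ℝ × ActTerm α) :=
  insert (t1, b1) (insert (t2, b2) (P' \ {(t0, ActTerm.comp b1 b2)}))

/-- The side conditions of a refinement step splitting `(t0, b1 ⊕ b2) ∈ P'`
into `(t1, b1)` and `(t2, b2)`. -/
def SplitOk (P' : Set (ℝ × ActTerm α)) (t0 t1 t2 : ℝ) (b1 b2 : ActTerm α) : Prop :=
  (t0, ActTerm.comp b1 b2) ∈ P' ∧
  t0 - delta ActTerm.toA P' t0 b1.toA.dur (b1.toA.dur + b2.toA.dur) < t1 ∧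
  t1 < t0 ∧ t1 + b1.toA.dur < t2 ∧ t2 < t0 + b1.toA.dur

/-- Refined plans of (the base plan of) `P#`, obtained by iteratively
splitting time-stamped macro-actions (Definition 3). -/
inductive Refined (Ps : Set (ℝ × ActTerm α)) : Set (ℝ × ActTerm α) → Prop
  | base : Refined Ps Ps
  | step {P' : Set (ℝ × ActTerm α)} {t0 t1 t2 : ℝ} {b1 b2 : ActTerm α} :
      Refined Ps P' → SplitOk P' t0 t1 t2 b1 b2 →
      Refined Ps (splitPlan P' t0 t1 t2 b1 b2)

/-- `refine_P(v, (t1, t2))` relative to the induced sequence `σ` of `P`: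
the least time stamp before `t1` from which the atom `v` remains true up to
(just before) `t2` without being protected against by a mutex atom `x(v)` of a
macro-action in progress, or the greatest event time stamp of `P` if no such
time stamp exists. -/
noncomputable def refineT (P : Set (ℝ × ActTerm α)) (σ : ℕ → TState α)
    (v : α) (t1 t2 : ℝ) : ℝ :=
  sInf ({sSup (evTimes ActTerm.toA P)} ∪
    {τ | ∃ p ∈ P, τ = p.1 + p.2.toA.dur ∧ τ < t1 ∧ v ∈ p.2.toA.effEp ∧
      (∀ i ≤ 2 * P.ncard, τ ≤ (σ i).1 → (σ i).1 < t2 → v ∈ (σ i).2.1) ∧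
      ¬∃ q ∈ P, (true, v) ∈ q.2.aux ∧ q.1 < t2 ∧ τ < q.1 + q.2.toA.dur} ∪
    {τ | ∃ p ∈ P, τ = p.1 ∧ τ < t1 ∧ v ∈ p.2.toA.effSp ∧
      (∀ i ≤ 2 * P.ncard, τ ≤ (σ i).1 → (σ i).1 < t2 → v ∈ (σ i).2.1) ∧
      ¬∃ q ∈ P, (true, v) ∈ q.2.aux ∧ q.1 < t2 ∧ τ < q.1 + q.2.toA.dur} ∪
    {τ | τ = 0 ∧ (∀ i ≤ 2 * P.ncard, (σ i).1 < t2 → v ∈ (σ i).2.1) ∧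
      ¬∃ q ∈ P, (true, v) ∈ q.2.aux ∧ q.1 < t2})

/-- The three `refine` bounds of the induction hypothesis in the proof of
Theorem 1: for every time-stamped action of `P`, the start, invariant and end
preconditions are established early enough and protected long enough. -/
def RefineBounds (P : Set (ℝ × ActTerm α)) (σ : ℕ → TState α) : Prop :=
  ∀ p ∈ P,
    (∀ v ∈ p.2.toA.preS, refineT P σ v p.1 p.1 < p.1) ∧
    (∀ v ∈ p.2.toA.preInv, ∀ j, j < 2 * P.ncard → (σ j).1 = p.1 →
      refineT P σ v ((σ (j + 1)).1) (p.1 + p.2.toA.dur) ≤ p.1) ∧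
    (∀ v ∈ p.2.toA.preE,
      refineT P σ v (p.1 + p.2.toA.dur) (p.1 + p.2.toA.dur) < p.1 + p.2.toA.dur)

end Refine

section InducedSequences

variable {α β : Type*} {f : β → DAction α} {P Q : Set (ℝ × β)} {s0 : Set α}
  {σ τ : ℕ → TState α}

namespace InducedSeq

lemma le_of_mem_sched (hσ : InducedSeq f P s0 σ) (hd : ∀ p ∈ P, 0 < (f p.2).dur) :
    ∀ i ≤ 2 * P.ncard, ∀ e ∈ (σ i).2.2, (σ i).1 ≤ e.1 := by
  intro i
  induction i with
  | zero => intro _ e he; simp [hσ.1] at he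
  | succ k ih =>
    intro hk e he
    obtain ⟨⟨-, hmin⟩, hstep⟩ := hσ.2 (k + 1) (by omega) hk
    simp only [Nat.add_sub_cancel] at hmin hstep
    rcases hstep with ⟨b, hb, -, hE⟩ | ⟨e', -, -, -, hE⟩
    · rw [hE] at he
      rcases he with rfl | he
      · have := hd _ hb
        simp only [schedOf]
        linarith
      · exact hmin _ (Or.inr ⟨e, he, rfl⟩)
    · rw [hE] at he
      exact hmin _ (Or.inr ⟨e, he.1, rfl⟩)

lemma time_le_succ (hσ : InducedSeq f P s0 σ) (hd : ∀ p ∈ P, 0 < (f p.2).dur)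
    {i : ℕ} (hi : i + 1 ≤ 2 * P.ncard) : (σ i).1 ≤ (σ (i + 1)).1 := by
  obtain ⟨⟨hmem, -⟩, -⟩ := hσ.2 (i + 1) (by omega) hi
  simp only [Nat.add_sub_cancel] at hmem
  rcases hmem with ⟨b, -, hb⟩ | ⟨e, he, het⟩
  · exact hb.le
  · rw [← het]
    exact hσ.le_of_mem_sched hd i (by omega) e he

lemma time_le (hσ : InducedSeq f P s0 σ) (hd : ∀ p ∈ P, 0 < (f p.2).dur) {i j : ℕ}
    (hij : i ≤ j) (hj : j ≤ 2 * P.ncard) : (σ i).1 ≤ (σ j).1 := by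
  induction j, hij using Nat.le_induction with
  | base => rfl
  | succ k _ ih => exact (ih (by omega)).trans (hσ.time_le_succ hd hj)

lemma exists_of_mem_sched (hσ : InducedSeq f P s0 σ) :
    ∀ i ≤ 2 * P.ncard, ∀ e ∈ (σ i).2.2, ∃ p ∈ P, e = schedOf p.1 (f p.2) := by
  intro i
  induction i with
  | zero => intro _ e he; simp [hσ.1] at he
  | succ k ih =>
    intro hk e he
    obtain ⟨-, hstep⟩ := hσ.2 (k + 1) (by omega) hk
    simp only [Nat.add_sub_cancel] at hstep
    rcases hstep with ⟨b, hb, -, hE⟩ | ⟨e', -, -, -, hE⟩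
    · rw [hE] at he
      rcases he with rfl | he
      · exact ⟨_, hb, rfl⟩
      · exact ih (by omega) e he
    · rw [hE] at he
      exact ih (by omega) e he.1

lemma mem_evTimes (hσ : InducedSeq f P s0 σ) {i : ℕ} (h1 : 1 ≤ i) (hi : i ≤ 2 * P.ncard) :
    (σ i).1 ∈ Prod.fst '' P ∪ (fun p => p.1 + (f p.2).dur) '' P := by
  obtain ⟨⟨hmem, -⟩, -⟩ := hσ.2 i h1 hi
  rcases hmem with ⟨b, hb, -⟩ | ⟨e, he, het⟩
  · exact Or.inl ⟨_, hb, rfl⟩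
  · obtain ⟨p, hp, rfl⟩ := hσ.exists_of_mem_sched (i - 1) (by omega) e he
    exact Or.inr ⟨p, hp, het⟩

end InducedSeq

lemma IsPlan.start_ne_end (hP : IsPlan f P) (hd : ∀ p ∈ P, 0 < (f p.2).dur)
    {p q : ℝ × β} (hp : p ∈ P) (hq : q ∈ P) : p.1 + (f p.2).dur ≠ q.1 := by
  by_cases h : p = q
  · subst h
    have := hd p hp
    linarith
  · exact (hP.2.2 p hp q hq h).2.1

lemma IsPlan.eq_of_start_eq (hP : IsPlan f P) {p q : ℝ × β} (hp : p ∈ P) (hq : q ∈ P)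
    (h : p.1 = q.1) : p = q := by
  by_contra hne
  exact (hP.2.2 p hp q hq hne).1 h

lemma IsPlan.eq_of_end_eq (hP : IsPlan f P) {p q : ℝ × β} (hp : p ∈ P) (hq : q ∈ P)
    (h : p.1 + (f p.2).dur = q.1 + (f q.2).dur) : p = q := by
  by_contra hne
  exact (hP.2.2 p hp q hq hne).2.2 h

namespace InducedSeq

lemma lt_of_mem_sched (hσ : InducedSeq f P s0 σ) (hP : IsPlan f P)
    (hd : ∀ p ∈ P, 0 < (f p.2).dur) :
    ∀ i ≤ 2 * P.ncard, ∀ e ∈ (σ i).2.2, (σ i).1 < e.1 := by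
  intro i
  induction i with
  | zero => intro _ e he; simp [hσ.1] at he
  | succ k ih =>
    intro hk e he
    refine lt_of_le_of_ne (hσ.le_of_mem_sched hd _ hk e he) fun heq => ?_
    obtain ⟨-, hstep⟩ := hσ.2 (k + 1) (by omega) hk
    simp only [Nat.add_sub_cancel] at hstep
    obtain ⟨p, hp, hpe⟩ := hσ.exists_of_mem_sched _ hk e he
    rcases hstep with ⟨b, hb, -, -⟩ | ⟨e', he', het', -, hE⟩
    · refine hP.start_ne_end hd hp hb ?_
      rw [heq, hpe]
      rfl
    · rw [hE] at he
      obtain ⟨q, hq, hqe⟩ := hσ.exists_of_mem_sched k (by omega) e' he'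
      refine he.2 ?_
      have : p = q := by
        refine hP.eq_of_end_eq hp hq ?_
        have h : e.1 = e'.1 := by rw [het', heq]
        rw [hpe, hqe] at h
        exact h
      rw [mem_singleton_iff, hpe, hqe, this]

lemma time_lt_succ (hσ : InducedSeq f P s0 σ) (hP : IsPlan f P)
    (hd : ∀ p ∈ P, 0 < (f p.2).dur) {i : ℕ} (hi : i + 1 ≤ 2 * P.ncard) :
    (σ i).1 < (σ (i + 1)).1 := by
  obtain ⟨⟨hmem, -⟩, -⟩ := hσ.2 (i + 1) (by omega) hi
  simp only [Nat.add_sub_cancel] at hmem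
  rcases hmem with ⟨b, -, hb⟩ | ⟨e, he, het⟩
  · exact hb
  · rw [← het]
    exact hσ.lt_of_mem_sched hP hd i (by omega) e he

lemma time_lt (hσ : InducedSeq f P s0 σ) (hP : IsPlan f P)
    (hd : ∀ p ∈ P, 0 < (f p.2).dur) {i j : ℕ} (hij : i < j) (hj : j ≤ 2 * P.ncard) :
    (σ i).1 < (σ j).1 :=
  (hσ.time_lt_succ hP hd (by omega)).trans_le (hσ.time_le hd hij hj)

/-- Every start time of a plan is reached by the end of its induced sequence. -/
lemma start_le_last (hσ : InducedSeq f P s0 σ) (hP : IsPlan f P)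
    (hd : ∀ p ∈ P, 0 < (f p.2).dur) {p : ℝ × β} (hp : p ∈ P) :
    p.1 ≤ (σ (2 * P.ncard)).1 := by
  by_contra! hlt
  set S : Set ℝ := Prod.fst '' P ∪ (fun p => p.1 + (f p.2).dur) '' P with hS
  have hfin : S.Finite := (hP.1.image _).union (hP.1.image _)
  have hpS : p.1 ∈ S := Or.inl ⟨p, hp, rfl⟩
  have hcard : S.ncard ≤ 2 * P.ncard := by
    rw [hS]
    have h1 := ncard_union_le (Prod.fst '' P) ((fun p => p.1 + (f p.2).dur) '' P)
    have h2 := ncard_image_le (f := Prod.fst) hP.1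
    have h3 := ncard_image_le (f := fun p : ℝ × β => p.1 + (f p.2).dur) hP.1
    omega
  have hlt' := ncard_sdiff_singleton_lt_of_mem hpS hfin
  have hfin' : (S \ {p.1}).Finite := hfin.sdiff
  rw [ncard_eq_toFinset_card _ hfin'] at hlt'
  obtain ⟨i, hi, j, hj, hne, heq⟩ := Finset.exists_ne_map_eq_of_card_lt_of_maps_to
    (s := Finset.Icc 1 (2 * P.ncard)) (t := hfin'.toFinset) (f := fun i => (σ i).1)
    (by rw [Nat.card_Icc]; omega)
    (by
      intro i hi
      simp only [Finset.coe_Icc, mem_Icc] at hi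
      simp only [Finite.coe_toFinset]
      exact ⟨hσ.mem_evTimes hi.1 hi.2,
        ((hσ.time_le hd hi.2 le_rfl).trans_lt hlt).ne⟩)
  simp only [Finset.mem_Icc] at hi hj
  rcases lt_or_gt_of_ne hne with h | h
  · exact (hσ.time_lt hP hd h hj.2).ne heq
  · exact (hσ.time_lt hP hd h hi.2).ne heq.symm

/-- Induced sequences of plans that start the same actions before `T` agree before `T`. -/
lemma eq_of_agree_below (hσ : InducedSeq f P s0 σ) (hτ : InducedSeq f Q s0 τ)
    (hQ : IsPlan f Q) (hdP : ∀ p ∈ P, 0 < (f p.2).dur) (hdQ : ∀ p ∈ Q, 0 < (f p.2).dur)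
    {T : ℝ} (hPQ : ∀ p, p.1 < T → (p ∈ P ↔ p ∈ Q)) :
    ∀ i ≤ 2 * P.ncard, i ≤ 2 * Q.ncard → ((σ i).1 < T ∨ (τ i).1 < T) → σ i = τ i := by
  intro i
  induction i with
  | zero => intros; rw [hσ.1, hτ.1]
  | succ k ih =>
    intro hkP hkQ hlt
    have hst : σ k = τ k := ih (by omega) (by omega)
      (hlt.imp (hσ.time_le_succ hdP hkP).trans_lt (hτ.time_le_succ hdQ hkQ).trans_lt)
    obtain ⟨⟨hmP, hminP⟩, hsP⟩ := hσ.2 (k + 1) (by omega) hkP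
    obtain ⟨⟨hmQ, hminQ⟩, hsQ⟩ := hτ.2 (k + 1) (by omega) hkQ
    simp only [Nat.add_sub_cancel, hst] at hmP hminP hsP hmQ hminQ hsQ
    have hcand : ∀ t < T, t ∈ candTimes f P (τ k) ↔ t ∈ candTimes f Q (τ k) := by
      intro t ht
      simp only [candTimes, mem_union, mem_ofPred_eq]
      refine or_congr (exists_congr fun b => and_congr_left fun _ => hPQ (t, b) ht) Iff.rfl
    have htime : (σ (k + 1)).1 = (τ (k + 1)).1 := by
      rcases hlt with h | h
      · have h1 := hminQ _ ((hcand _ h).1 hmP)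
        exact le_antisymm (hminP _ ((hcand _ (h1.trans_lt h)).2 hmQ)) h1
      · have h1 := hminP _ ((hcand _ h).2 hmQ)
        exact le_antisymm h1 (hminQ _ ((hcand _ (h1.trans_lt h)).1 hmP))
    have hT : (τ (k + 1)).1 < T := by
      rcases hlt with h | h
      · rwa [← htime]
      · exact h
    have hE := hτ.exists_of_mem_sched k (by omega)
    rw [htime] at hsP
    refine Prod.ext htime ?_
    rcases hsP with ⟨b, hb, hs, hE1⟩ | ⟨e, he, het, hs, hE1⟩ <;>
      rcases hsQ with ⟨b', hb', hs', hE1'⟩ | ⟨e', he', het', hs', hE1'⟩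
    · obtain rfl : b = b' :=
        congrArg Prod.snd (hQ.eq_of_start_eq ((hPQ _ hT).1 hb) hb' rfl)
      exact Prod.ext (hs.trans hs'.symm) (hE1.trans hE1'.symm)
    · obtain ⟨p, hp, rfl⟩ := hE e' he'
      exact absurd het' (hQ.start_ne_end hdQ hp ((hPQ _ hT).1 hb))
    · obtain ⟨p, hp, rfl⟩ := hE e he
      exact absurd het (hQ.start_ne_end hdQ hp hb')
    · obtain ⟨p, hp, rfl⟩ := hE e he
      obtain ⟨q, hq, rfl⟩ := hE e' he'
      obtain rfl : p = q := hQ.eq_of_end_eq hp hq (het.trans het'.symm)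
      exact Prod.ext (hs.trans hs'.symm) (hE1.trans hE1'.symm)

end InducedSeq

lemma finite_evTimes (hP : P.Finite) : (evTimes f P).Finite := by
  refine Finite.insert _ (Finite.union ?_ ?_)
  · refine (hP.image Prod.fst).subset ?_
    rintro t ⟨b, hb⟩
    exact ⟨_, hb, rfl⟩
  · refine (hP.image fun p => p.1 + (f p.2).dur).subset ?_
    rintro t ⟨p, hp, rfl⟩
    exact ⟨p, hp, rfl⟩

lemma delta_le {t0 d1 d s : ℝ} (hs : s ∈ evTimes f P) (hst : s < t0) :
    delta f P t0 d1 d ≤ t0 - s := by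
  refine csInf_le ⟨0, ?_⟩ ⟨s, hs, Or.inl ⟨rfl, hst⟩⟩
  rintro x ⟨s, -, ⟨rfl, h⟩ | ⟨rfl, h⟩ | ⟨rfl, h⟩⟩ <;> linarith

end InducedSequences

section RefinedPlans

variable {α : Type*}

lemma ActTerm.Good.dur_pos {b : ActTerm α} (hb : b.Good) : 0 < b.toA.dur := by
  induction b with
  | prim a => exact hb.1
  | comp b1 b2 h1 h2 => exact add_pos (h1 hb.1) (h2 hb.2.1)

lemma good_of_mem_splitPlan {P' : Set (ℝ × ActTerm α)} {t0 t1 t2 : ℝ} {b1 b2 : ActTerm α}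
    (hP' : ∀ p ∈ P', p.2.Good) (hmem : (t0, ActTerm.comp b1 b2) ∈ P') :
    ∀ p ∈ splitPlan P' t0 t1 t2 b1 b2, p.2.Good := by
  have h := hP' _ hmem
  rintro p (rfl | rfl | hp)
  · exact h.1
  · exact h.2.1
  · exact hP' p hp.1

lemma Refined.good {Ps P' : Set (ℝ × ActTerm α)} (hPs : ∀ p ∈ Ps, p.2.Good)
    (h : Refined Ps P') : ∀ p ∈ P', p.2.Good := by
  induction h with
  | base => exact hPs
  | step _ hs ih => exact good_of_mem_splitPlan ih hs.1

/-- The times from which `refineT` takes the minimum, other than the greatest event time. -/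
def refineCandidates (P : Set (ℝ × ActTerm α)) (σ : ℕ → TState α) (v : α) (t1 t2 : ℝ) :
    Set ℝ :=
  {τ | ∃ p ∈ P, τ = p.1 + p.2.toA.dur ∧ τ < t1 ∧ v ∈ p.2.toA.effEp ∧
      (∀ i ≤ 2 * P.ncard, τ ≤ (σ i).1 → (σ i).1 < t2 → v ∈ (σ i).2.1) ∧
      ¬∃ q ∈ P, (true, v) ∈ q.2.aux ∧ q.1 < t2 ∧ τ < q.1 + q.2.toA.dur} ∪
  {τ | ∃ p ∈ P, τ = p.1 ∧ τ < t1 ∧ v ∈ p.2.toA.effSp ∧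
      (∀ i ≤ 2 * P.ncard, τ ≤ (σ i).1 → (σ i).1 < t2 → v ∈ (σ i).2.1) ∧
      ¬∃ q ∈ P, (true, v) ∈ q.2.aux ∧ q.1 < t2 ∧ τ < q.1 + q.2.toA.dur} ∪
  {τ | τ = 0 ∧ (∀ i ≤ 2 * P.ncard, (σ i).1 < t2 → v ∈ (σ i).2.1) ∧
      ¬∃ q ∈ P, (true, v) ∈ q.2.aux ∧ q.1 < t2}

lemma refineT_eq_sInf_insert (P : Set (ℝ × ActTerm α)) (σ : ℕ → TState α) (v : α)
    (t1 t2 : ℝ) :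
    refineT P σ v t1 t2 =
      sInf (insert (sSup (evTimes ActTerm.toA P)) (refineCandidates P σ v t1 t2)) := by
  rw [refineT, refineCandidates, union_assoc, union_assoc, union_assoc, singleton_union]

lemma refineCandidates_subset_evTimes (P : Set (ℝ × ActTerm α)) (σ : ℕ → TState α) (v : α)
    (t1 t2 : ℝ) : refineCandidates P σ v t1 t2 ⊆ evTimes ActTerm.toA P := by
  rintro τ ((⟨p, hp, rfl, -⟩ | ⟨p, hp, rfl, -⟩) | ⟨rfl, -⟩)
  · exact Or.inr (Or.inr ⟨p, hp, rfl⟩)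
  · exact Or.inr (Or.inl ⟨_, hp⟩)
  · exact Or.inl rfl

lemma lt_of_mem_refineCandidates {P : Set (ℝ × ActTerm α)} {σ : ℕ → TState α} {v : α}
    {t1 t2 τ : ℝ} (ht1 : 0 < t1) (h : τ ∈ refineCandidates P σ v t1 t2) : τ < t1 := by
  rcases h with (⟨p, -, -, h, -⟩ | ⟨p, -, -, h, -⟩) | ⟨rfl, -⟩
  · exact h
  · exact h
  · exact ht1

end RefinedPlans

lemma csInf_insert_of_forall_le {S : Set ℝ} {M : ℝ} (hS : S.Nonempty) (hb : BddBelow S)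
    (h : ∀ s ∈ S, s ≤ M) : sInf (insert M S) = sInf S := by
  rw [csInf_insert hb hS, inf_eq_right]
  obtain ⟨s, hs⟩ := hS
  exact (csInf_le hb hs).trans (h s hs)

/-- Condition (1) in the proof of Theorem 1: after splitting
`(t0, a1 ⊕ a2) ∈ P'` into `(t1, a1)` and `(t2, a2)`, for each
`v ∈ pre_s(a1)` we have `refine_P(v, (t1, t1)) = refine_{P'}(v, (t0, t0)) < t1`. -/
theorem split_refine_start {α : Type*} (V : Set α) (A : Set (ActTerm α))
    (s0 g : Set α) (hT : TaskWF V A s0 g)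
    (Ps P' : Set (ℝ × ActTerm α)) (hPs : SafeSolution A s0 g Ps)
    (hP' : Refined Ps P') (hsol : OrigSolution s0 g P')
    (hbounds : ∀ σ', InducedSeq ActTerm.toA P' s0 σ' → RefineBounds P' σ')
    (t0 t1 t2 : ℝ) (b1 b2 : ActTerm α) (hsplit : SplitOk P' t0 t1 t2 b1 b2)
    (σ' σ : ℕ → TState α)
    (hσ' : InducedSeq ActTerm.toA P' s0 σ')
    (hσ : InducedSeq ActTerm.toA (splitPlan P' t0 t1 t2 b1 b2) s0 σ) :
    ∀ v ∈ b1.toA.preS,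
      refineT (splitPlan P' t0 t1 t2 b1 b2) σ v t1 t1 = refineT P' σ' v t0 t0 ∧
      refineT P' σ' v t0 t0 < t1 := by
  intro v hv
  obtain ⟨hmem, hlo, ht10, ht12, ht20⟩ := hsplit
  have hplan := hsol.1
  have hfin := hplan.1
  have hgood : ∀ p ∈ P', p.2.Good := hP'.good fun p hp => (hT.2.2.2 _ (hPs.1 p hp)).1
  have hgood' := good_of_mem_splitPlan (t1 := t1) (t2 := t2) hgood hmem
  have hd : ∀ p ∈ P', 0 < p.2.toA.dur := fun p hp => (hgood p hp).dur_pos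
  have hd1 : 0 < b1.toA.dur := (hgood _ hmem).1.dur_pos
  have hd2 : 0 < b2.toA.dur := (hgood _ hmem).2.1.dur_pos
  have hd0 : 0 < (ActTerm.comp b1 b2).toA.dur := hd _ hmem
  have ht0 : 0 < t0 := hplan.2.1 _ hmem
  have hgap : ∀ s ∈ evTimes ActTerm.toA P', s < t0 → s < t1 := by
    intro s hs hst
    have := delta_le (d1 := b1.toA.dur) (d := b1.toA.dur + b2.toA.dur) hs hst
    linarith
  have ht1 : 0 < t1 := hgap 0 (Or.inl rfl) ht0
  have hstart : ∀ p ∈ P', p.1 ∈ evTimes ActTerm.toA P' := fun p hp => Or.inr (Or.inl ⟨_, hp⟩)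
  have hend : ∀ p ∈ P', p.1 + p.2.toA.dur ∈ evTimes ActTerm.toA P' :=
    fun p hp => Or.inr (Or.inr ⟨p, hp, rfl⟩)
  set P := splitPlan P' t0 t1 t2 b1 b2 with hPdef
  have hfinP : P.Finite := (hfin.sdiff.insert _).insert _
  have hagree : ∀ p, p.1 < t1 → (p ∈ P ↔ p ∈ P') := by
    intro p hp
    constructor
    · rintro (rfl | rfl | h)
      · exact absurd hp (lt_irrefl _)
      · exact absurd hp (by simp only; linarith)
      · exact h.1
    · intro h
      refine Or.inr (Or.inr ⟨h, ?_⟩)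
      rintro rfl
      exact absurd hp (by simp only; linarith)
  have hdP : ∀ p ∈ P, 0 < p.2.toA.dur := fun p hp => (hgood' p hp).dur_pos
  have hcard : P'.ncard ≤ P.ncard := by
    rw [← ncard_exchange (a := (t1, b1)) (fun h => (hgap _ (hstart _ h) ht10).false) hmem]
    exact ncard_le_ncard (insert_subset_insert (subset_insert _ _)) hfinP
  have heq := hσ.eq_of_agree_below hσ' hplan hdP hd hagree
  have hlast : t1 < (σ' (2 * P'.ncard)).1 :=
    ht10.trans_le (hσ'.start_le_last hplan hd hmem)
  have htime : ∀ i ≤ 2 * P'.ncard, (σ' i).1 < t0 → (σ' i).1 < t1 := by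
    intro i hi hlt
    rcases Nat.eq_zero_or_pos i with rfl | h
    · rw [hσ'.1]; exact ht1
    · refine hgap _ ?_ hlt
      rcases hσ'.mem_evTimes h hi with ⟨p, hp, h⟩ | ⟨p, hp, h⟩
      · exact h ▸ hstart p hp
      · exact h ▸ hend p hp
  have hstates : ∀ R : TState α → Prop,
      (∀ i ≤ 2 * P.ncard, (σ i).1 < t1 → R (σ i)) ↔
        (∀ i ≤ 2 * P'.ncard, (σ' i).1 < t0 → R (σ' i)) := by
    intro R
    constructor
    · intro h i hi hlt
      have hlt1 := htime i hi hlt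
      have he := heq i (by omega) hi (Or.inr hlt1)
      rw [← he]
      exact h i (by omega) (by rwa [he])
    · intro h i hi hlt
      have hi' : i ≤ 2 * P'.ncard := by
        by_contra! hcon
        have h1 : (σ (2 * P'.ncard)).1 < t1 := (hσ.time_le hdP hcon.le hi).trans_lt hlt
        rw [heq _ (by omega) le_rfl (Or.inl h1)] at h1
        exact lt_asymm h1 hlast
      have he := heq i hi hi' (Or.inl hlt)
      rw [he] at hlt ⊢
      exact h i hi' (hlt.trans ht10)
  have hmutex : ∀ R : ℝ × ActTerm α → Prop,
      (∃ q ∈ P, (true, v) ∈ q.2.aux ∧ q.1 < t1 ∧ R q) ↔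
        (∃ q ∈ P', (true, v) ∈ q.2.aux ∧ q.1 < t0 ∧ R q) := by
    intro R
    constructor
    · rintro ⟨q, hq, hx, hlt, hR⟩
      exact ⟨q, (hagree q hlt).1 hq, hx, hlt.trans ht10, hR⟩
    · rintro ⟨q, hq, hx, hlt, hR⟩
      have hlt1 := hgap _ (hstart q hq) hlt
      exact ⟨q, (hagree q hlt1).2 hq, hx, hlt1, hR⟩
  have hcand : refineCandidates P σ v t1 t1 = refineCandidates P' σ' v t0 t0 := by
    have hs1 : ∀ τ : ℝ, (∀ i ≤ 2 * P.ncard, τ ≤ (σ i).1 → (σ i).1 < t1 → v ∈ (σ i).2.1) ↔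
        (∀ i ≤ 2 * P'.ncard, τ ≤ (σ' i).1 → (σ' i).1 < t0 → v ∈ (σ' i).2.1) := by
      intro τ
      have := hstates fun s => τ ≤ s.1 → v ∈ s.2.1
      constructor
      · exact fun h i hi ha hb => this.1 (fun i hi hb ha => h i hi ha hb) i hi hb ha
      · exact fun h i hi ha hb => this.2 (fun i hi hb ha => h i hi ha hb) i hi hb ha
    have hm2 : (∃ q ∈ P, (true, v) ∈ q.2.aux ∧ q.1 < t1) ↔
        (∃ q ∈ P', (true, v) ∈ q.2.aux ∧ q.1 < t0) := by
      simpa using hmutex fun _ => True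
    unfold refineCandidates
    congr 1
    · congr 1
      · ext τ
        simp only [mem_ofPred_eq, hs1, hmutex]
        constructor
        · rintro ⟨p, hp, rfl, hlt, hr⟩
          have hlt' : p.1 < t1 := by linarith [hdP p hp]
          exact ⟨p, (hagree p hlt').1 hp, rfl, hlt.trans ht10, hr⟩
        · rintro ⟨p, hp, rfl, hlt, hr⟩
          have hlt1 := hgap _ (hend p hp) hlt
          have hlt' : p.1 < t1 := by linarith [hd p hp]
          exact ⟨p, (hagree p hlt').2 hp, rfl, hlt1, hr⟩
      · ext τ
        simp only [mem_ofPred_eq, hs1, hmutex]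
        constructor
        · rintro ⟨p, hp, rfl, hlt, hr⟩
          exact ⟨p, (hagree p hlt).1 hp, rfl, hlt.trans ht10, hr⟩
        · rintro ⟨p, hp, rfl, hlt, hr⟩
          have hlt1 := hgap _ (hstart p hp) hlt
          exact ⟨p, (hagree p hlt1).2 hp, rfl, hlt1, hr⟩
    · ext τ
      simp only [mem_ofPred_eq, hm2, hstates fun s => v ∈ s.2.1]
  have hbound : refineT P' σ' v t0 t0 < t0 :=
    (hbounds σ' hσ' _ hmem).1 v (Or.inl (Or.inl hv))
  have hM' : t0 ≤ sSup (evTimes ActTerm.toA P') :=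
    le_csSup (finite_evTimes hfin).bddAbove (hstart _ hmem)
  have hM : t1 ≤ sSup (evTimes ActTerm.toA P) :=
    le_csSup (finite_evTimes hfinP).bddAbove (Or.inr (Or.inl ⟨b1, Or.inl rfl⟩))
  rw [refineT_eq_sInf_insert] at hbound
  rw [refineT_eq_sInf_insert, refineT_eq_sInf_insert, hcand]
  have hlt : ∀ s ∈ refineCandidates P' σ' v t0 t0, s < t1 := fun s hs =>
    lt_of_mem_refineCandidates ht1 (hcand ▸ hs)
  have hSfin := (finite_evTimes hfin).subset (refineCandidates_subset_evTimes P' σ' v t0 t0)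
  have hne : (refineCandidates P' σ' v t0 t0).Nonempty := by
    by_contra hcon
    rw [not_nonempty_iff_eq_empty.1 hcon, insert_empty_eq, csInf_singleton] at hbound
    exact hbound.not_ge hM'
  rw [csInf_insert_of_forall_le hne hSfin.bddBelow fun s hs => (hlt s hs).le.trans hM,
    csInf_insert_of_forall_le hne hSfin.bddBelow
      fun s hs => ((hlt s hs).trans ht10).le.trans hM']
  exact ⟨rfl, hlt _ (hne.csInf_mem hSfin)⟩
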